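/- Let A ∈ ℝ^{n×n}, B ∈ ℝ^{n×m}, K ∈ ℝ^{m×n}, φ the componentwise saturation function, f(e, v) = Ae + B(φ(Ke + v) − v), and for J ⊆ {1,…,m} let M_J = A + Σ_{i∈J} B₍ᵢ₎Kᵢ. Let P ∈ ℝ^{n×n} be symmetric positive definite. Then for every e ∈ ℝⁿ and every v ∈ ℝᵐ with ‖v‖_∞ ≤ 1, f(e, v)ᵀ P f(e, v) ≤ max over J ⊆ {1,…,m} of eᵀ M_Jᵀ P M_J e. -/

import Mathlib

open Matrix

/-- Componentwise saturation function: φᵢ(u) = sign(uᵢ)·min{|uᵢ|, 1}. -/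
noncomputable def sat {m : ℕ} (u : Fin m → ℝ) : Fin m → ℝ :=
  fun i => Real.sign (u i) * min |u i| 1

/-- Saturated error map: f(e, v) = A e + B (φ(K e + v) − v). -/
noncomputable def fSat {n m : ℕ} (A : Matrix (Fin n) (Fin n) ℝ)
    (B : Matrix (Fin n) (Fin m) ℝ) (K : Matrix (Fin m) (Fin n) ℝ)
    (e : Fin n → ℝ) (v : Fin m → ℝ) : Fin n → ℝ :=
  A.mulVec e + B.mulVec (sat (K.mulVec e + v) - v)

/-- M_J = A + Σ_{i∈J} B₍ᵢ₎ Kᵢ. -/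
noncomputable def MJ {n m : ℕ} (A : Matrix (Fin n) (Fin n) ℝ)
    (B : Matrix (Fin n) (Fin m) ℝ) (K : Matrix (Fin m) (Fin n) ℝ)
    (J : Finset (Fin m)) : Matrix (Fin n) (Fin n) ℝ :=
  A + ∑ i ∈ J, Matrix.vecMulVec (fun r => B r i) (K i)

/-- The saturation increment is a fraction of the unsaturated increment. -/
theorem exists_sign_mul_min_sub_eq_mul (w v : ℝ) (hv : |v| ≤ 1) :
    ∃ d : ℝ, 0 ≤ d ∧ d ≤ 1 ∧ Real.sign (w + v) * min |w + v| 1 - v = d * w := by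
  obtain ⟨h1, h2⟩ := abs_le.mp hv
  rcases lt_or_ge 1 (w + v) with h | h
  · have hw : 0 < w := by linarith
    refine ⟨(1 - v) / w, div_nonneg (by linarith) hw.le, (div_le_one hw).2 (by linarith), ?_⟩
    rw [Real.sign_of_pos (by linarith), abs_of_pos (by linarith), min_eq_right h.le,
      div_mul_cancel₀ _ hw.ne']
    ring
  rcases lt_or_ge (w + v) (-1) with h' | h'
  · have hw : w < 0 := by linarith
    refine ⟨(-1 - v) / w, div_nonneg_of_nonpos (by linarith) hw.le,
      (div_le_one_of_neg hw).2 (by linarith), ?_⟩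
    rw [Real.sign_of_neg (by linarith), abs_of_neg (by linarith), min_eq_right (by linarith),
      div_mul_cancel₀ _ hw.ne]
    ring
  · refine ⟨1, zero_le_one, le_rfl, ?_⟩
    have hs : Real.sign (w + v) * |w + v| = w + v := by
      rcases lt_trichotomy (w + v) 0 with hn | hz | hp
      · rw [Real.sign_of_neg hn, abs_of_neg hn]; ring
      · simp [hz]
      · rw [Real.sign_of_pos hp, abs_of_pos hp]; ring
    rw [min_eq_left (abs_le.2 ⟨h', h⟩), hs]
    ring

/-- The quadratic form of a positive semidefinite real matrix is convex. -/
theorem Matrix.PosSemidef.convexOn_dotProduct_mulVec {n : Type*} [Fintype n]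
    {P : Matrix n n ℝ} (hP : P.PosSemidef) :
    ConvexOn ℝ Set.univ (fun x : n → ℝ => x ⬝ᵥ P *ᵥ x) := by
  refine ⟨convex_univ, fun x _ y _ a b ha hb hab => ?_⟩
  have h : 0 ≤ (x - y) ⬝ᵥ P *ᵥ (x - y) := by
    simpa using hP.dotProduct_mulVec_nonneg (x - y)
  obtain rfl : b = 1 - a := by linarith
  have h' := mul_nonneg (mul_nonneg ha hb) h
  simp only [mulVec_add, mulVec_sub, mulVec_smul, dotProduct_add, add_dotProduct, dotProduct_sub,
    sub_dotProduct, dotProduct_smul, smul_dotProduct, smul_eq_mul] at h' ⊢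
  linarith

/-- A convex function on a parallelotope is bounded by its value at some vertex. -/
theorem ConvexOn.exists_subset_le_add_sum {ι E : Type*} [AddCommGroup E]
    [Module ℝ E] {g : E → ℝ} (hg : ConvexOn ℝ Set.univ g) (y : ι → E) (d : ι → ℝ)
    (hd0 : ∀ i, 0 ≤ d i) (hd1 : ∀ i, d i ≤ 1) (s : Finset ι) (x : E) :
    ∃ J ⊆ s, g (x + ∑ i ∈ s, d i • y i) ≤ g (x + ∑ i ∈ J, y i) := by
  classical
  induction s using Finset.induction_on generalizing x with
  | empty => exact ⟨∅, subset_rfl, by simp⟩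
  | insert a s ha ih =>
    have hmax := hg.le_max_of_mem_segment (Set.mem_univ (x + ∑ i ∈ s, d i • y i))
      (Set.mem_univ (x + y a + ∑ i ∈ s, d i • y i))
      (z := x + ∑ i ∈ insert a s, d i • y i)
      ⟨1 - d a, d a, sub_nonneg.2 (hd1 a), hd0 a, by ring, by
        rw [Finset.sum_insert ha]; module⟩
    rcases le_max_iff.1 hmax with h | h
    · obtain ⟨J, hJ, hle⟩ := ih x
      exact ⟨J, hJ.trans (Finset.subset_insert a s), h.trans hle⟩
    · obtain ⟨J, hJ, hle⟩ := ih (x + y a)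
      refine ⟨insert a J, Finset.insert_subset_insert a hJ, ?_⟩
      rw [Finset.sum_insert (fun h => ha (hJ h)), ← add_assoc]
      exact h.trans hle

theorem MJ_mulVec {n m : ℕ} (A : Matrix (Fin n) (Fin n) ℝ)
    (B : Matrix (Fin n) (Fin m) ℝ) (K : Matrix (Fin m) (Fin n) ℝ)
    (J : Finset (Fin m)) (e : Fin n → ℝ) :
    (MJ A B K J).mulVec e = A *ᵥ e + ∑ i ∈ J, (K *ᵥ e) i • B.col i := by
  rw [MJ, add_mulVec, sum_mulVec]
  congr 1
  refine Finset.sum_congr rfl fun i _ => ?_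
  rw [vecMulVec_mulVec]
  ext r
  simp [mulVec, mul_comm]

theorem fSat_max_quadratic_bound {n m : ℕ} (A : Matrix (Fin n) (Fin n) ℝ)
    (B : Matrix (Fin n) (Fin m) ℝ) (K : Matrix (Fin m) (Fin n) ℝ)
    (P : Matrix (Fin n) (Fin n) ℝ) (hP : P.PosDef)
    (e : Fin n → ℝ) (v : Fin m → ℝ) (hv : ∀ i, |v i| ≤ 1) :
    (fSat A B K e v) ⬝ᵥ P.mulVec (fSat A B K e v) ≤
      Finset.univ.sup' Finset.univ_nonempty
        (fun J : Finset (Fin m) =>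
          ((MJ A B K J).mulVec e) ⬝ᵥ P.mulVec ((MJ A B K J).mulVec e)) := by
  choose d hd0 hd1 hd using fun i => exists_sign_mul_min_sub_eq_mul ((K *ᵥ e) i) (v i) (hv i)
  have hf : fSat A B K e v = A *ᵥ e + ∑ i, d i • ((K *ᵥ e) i • B.col i) := by
    rw [fSat]
    congr 1
    have h : sat (K *ᵥ e + v) - v = fun i => d i * (K *ᵥ e) i := funext hd
    rw [h]
    ext r
    rw [mulVec, dotProduct, Finset.sum_apply]
    refine Finset.sum_congr rfl fun i _ => ?_
    simp only [Pi.smul_apply, col_apply, smul_eq_mul]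
    ring
  obtain ⟨J, -, hJ⟩ := hP.posSemidef.convexOn_dotProduct_mulVec.exists_subset_le_add_sum
    (fun i => (K *ᵥ e) i • B.col i) d hd0 hd1 Finset.univ (A *ᵥ e)
  rw [hf]
  refine hJ.trans ?_
  rw [← MJ_mulVec]
  exact Finset.le_sup' (fun J : Finset (Fin m) =>
    ((MJ A B K J).mulVec e) ⬝ᵥ P.mulVec ((MJ A B K J).mulVec e)) (Finset.mem_univ J)
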